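/- Let X be the self-repelling random walk with directed edges and weight function w. Fix j ∈ ℤ and m ∈ ℕ. Then almost surely the inverse local times T±_{j,r} := min{n ≥ 0 : ℓ±(n,j) ≥ r} are finite for r ≤ m, the range ρ±_{j,r} − λ±_{j,r} is finite, and sup_{k∈ℤ} Λ±_{j,r}(k) is finite, where Λ±_{j,r}(k) := ℓ⁺(T±_{j,r},k) + ℓ⁻(T±_{j,r},k+1), λ±_{j,r} := inf{k : Λ±_{j,r}(k) > 0} and ρ±_{j,r} := sup{k : Λ±_{j,r}(k) > 0}. In particular, the walk visits every site and every edge of ℤ infinitely often almost surely. -/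

import Mathlib

open MeasureTheory Filter
open scoped BigOperators ENNReal Topology

noncomputable section

/-- The weight function `w` is positive, nondecreasing and satisfies
`lim_{z→∞} (w(z) - w(-z)) > 0`. -/
def GoodWeight (w : ℤ → ℝ) : Prop :=
  (∀ z, 0 < w z) ∧ (∀ z, w z ≤ w (z + 1)) ∧
    ∃ c > (0 : ℝ), ∀ᶠ z : ℤ in atTop, c ≤ w z - w (-z)

/-- Local time of the path `x` on the oriented edge from `k` to `k+1` up to time `n`. -/
def dirLocP (x : ℕ → ℤ) (n : ℕ) (k : ℤ) : ℕ :=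
  ((Finset.range n).filter fun j => x j = k ∧ x (j + 1) = k + 1).card

/-- Local time of the path `x` on the oriented edge from `k` to `k-1` up to time `n`. -/
def dirLocM (x : ℕ → ℤ) (n : ℕ) (k : ℤ) : ℕ :=
  ((Finset.range n).filter fun j => x j = k ∧ x (j + 1) = k - 1).card

/-- The conditional probability, given the past path `x` up to time `n`, that the
self-repelling walk with weight `w` makes the step `x n → x (n+1)`. -/
def stepProb (w : ℤ → ℝ) (x : ℕ → ℤ) (n : ℕ) : ℝ :=
  let Δ : ℤ := (dirLocP x n (x n) : ℤ) - (dirLocM x n (x n) : ℤ)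
  if x (n + 1) = x n + 1 then w (-Δ) / (w Δ + w (-Δ))
  else if x (n + 1) = x n - 1 then w Δ / (w Δ + w (-Δ))
  else 0

/-- `X` is the self-repelling random walk with directed edges and weight function `w`:
it starts at `0` and its cylinder probabilities evolve by the self-repelling
transition probabilities. -/
def IsSRW {Ω : Type*} [MeasurableSpace Ω] (μ : Measure Ω) (w : ℤ → ℝ)
    (X : ℕ → Ω → ℤ) : Prop :=
  (∀ n, Measurable (X n)) ∧
  μ {ω | X 0 ω = 0} = 1 ∧
  ∀ (n : ℕ) (x : ℕ → ℤ),
    μ {ω | ∀ i ≤ n + 1, X i ω = x i} =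
      μ {ω | ∀ i ≤ n, X i ω = x i} * ENNReal.ofReal (stepProb w x n)

/-- Inverse local time `T⁺_{j,r} = min{n ≥ 0 : ℓ⁺(n,j) ≥ r}` of the path `x`. -/
def Tp (x : ℕ → ℤ) (j : ℤ) (r : ℕ) : ℕ := sInf {n | r ≤ dirLocP x n j}

/-- Inverse local time `T⁻_{j,r} = min{n ≥ 0 : ℓ⁻(n,j) ≥ r}` of the path `x`. -/
def Tm (x : ℕ → ℤ) (j : ℤ) (r : ℕ) : ℕ := sInf {n | r ≤ dirLocM x n j}

/-- `Λ⁺_{j,r}(k) = ℓ⁺(T⁺_{j,r},k) + ℓ⁻(T⁺_{j,r},k+1)`. -/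
def LamP (x : ℕ → ℤ) (j : ℤ) (r : ℕ) (k : ℤ) : ℕ :=
  dirLocP x (Tp x j r) k + dirLocM x (Tp x j r) (k + 1)

/-- `Λ⁻_{j,r}(k) = ℓ⁺(T⁻_{j,r},k) + ℓ⁻(T⁻_{j,r},k+1)`. -/
def LamM (x : ℕ → ℤ) (j : ℤ) (r : ℕ) (k : ℤ) : ℕ :=
  dirLocP x (Tm x j r) k + dirLocM x (Tm x j r) (k + 1)

/-- Leftmost edge `λ⁺_{j,r}` visited before `T⁺_{j,r}`. -/
def lamEdgeP (x : ℕ → ℤ) (j : ℤ) (r : ℕ) : ℤ := sInf {k : ℤ | 0 < LamP x j r k}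

/-- Leftmost edge `λ⁻_{j,r}` visited before `T⁻_{j,r}`. -/
def lamEdgeM (x : ℕ → ℤ) (j : ℤ) (r : ℕ) : ℤ := sInf {k : ℤ | 0 < LamM x j r k}

/-- Rightmost edge `ρ⁺_{j,r}` visited before `T⁺_{j,r}`. -/
def rhoEdgeP (x : ℕ → ℤ) (j : ℤ) (r : ℕ) : ℤ := sSup {k : ℤ | 0 < LamP x j r k}

/-- Rightmost edge `ρ⁻_{j,r}` visited before `T⁻_{j,r}`. -/
def rhoEdgeM (x : ℕ → ℤ) (j : ℤ) (r : ℕ) : ℤ := sSup {k : ℤ | 0 < LamM x j r k}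

open ProbabilityTheory Preorder

/-- Probability of stepping to the right from a site whose local time difference is `δ`. -/
def upProb (w : ℤ → ℝ) (δ : ℤ) : ℝ := w (-δ) / (w δ + w (-δ))

theorem upProb_pos {w : ℤ → ℝ} (hw : ∀ z, 0 < w z) (δ : ℤ) : 0 < upProb w δ :=
  div_pos (hw _) (add_pos (hw _) (hw _))

theorem upProb_add_upProb_neg {w : ℤ → ℝ} (hw : ∀ z, 0 < w z) (δ : ℤ) :
    upProb w δ + upProb w (-δ) = 1 := by
  have h1 := hw δ
  have h2 := hw (-δ)
  simp only [upProb, neg_neg]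
  field_simp
  ring

theorem upProb_le_upProb_neg {w : ℤ → ℝ} (hw : ∀ z, 0 < w z) (hmono : Monotone w) {δ : ℤ}
    (hδ : 0 ≤ δ) : upProb w δ ≤ upProb w (-δ) := by
  have h1 := hw δ
  have h2 := hw (-δ)
  simp only [upProb, neg_neg]
  rw [add_comm (w (-δ))]
  gcongr
  exact hmono (by lia)

theorem ofReal_upProb_add {w : ℤ → ℝ} (hw : ∀ z, 0 < w z) (δ : ℤ) :
    ENNReal.ofReal (upProb w δ) + ENNReal.ofReal (upProb w (-δ)) = 1 := by
  rw [← ENNReal.ofReal_add (upProb_pos hw _).le (upProb_pos hw _).le, upProb_add_upProb_neg hw,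
    ENNReal.ofReal_one]

/-- `A` depends only on the coordinates up to `n`. -/
def DeterminedBy (A : Set (ℕ → ℤ)) (n : ℕ) : Prop :=
  ∀ c c', (∀ i ≤ n, c i = c' i) → c ∈ A → c' ∈ A

theorem DeterminedBy.eq_preimage {A : Set (ℕ → ℤ)} {n : ℕ} (h : DeterminedBy A n) :
    A = frestrictLe (π := fun _ ↦ ℤ) n ⁻¹' (frestrictLe (π := fun _ ↦ ℤ) n '' A) := by
  refine Set.Subset.antisymm (Set.subset_preimage_image _ _) ?_
  rintro c ⟨c', hc', h'⟩
  refine h c' c (fun i hi ↦ ?_) hc'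
  simpa using congrFun h' ⟨i, Finset.mem_Iic.2 hi⟩

theorem DeterminedBy.measurableSet {A : Set (ℕ → ℤ)} {n : ℕ} (h : DeterminedBy A n) :
    MeasurableSet A := by
  rw [h.eq_preimage]
  exact (measurable_frestrictLe (X := fun _ ↦ ℤ) n) (Set.to_countable _).measurableSet

theorem DeterminedBy.inter {A B : Set (ℕ → ℤ)} {n : ℕ} (hA : DeterminedBy A n)
    (hB : DeterminedBy B n) : DeterminedBy (A ∩ B) n :=
  fun c c' hc h ↦ ⟨hA c c' hc h.1, hB c c' hc h.2⟩

/-- `ν` is the law of the nearest-neighbour chain on `ℤ` started at `0` which describes the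
successive local time differences at a single site. -/
structure IsStackLaw (w : ℤ → ℝ) (ν : Measure (ℕ → ℤ)) : Prop where
  zero : ∀ᵐ c ∂ν, c 0 = 0
  up : ∀ (n : ℕ) (A : Set (ℕ → ℤ)) (δ : ℤ), DeterminedBy A n → (∀ c ∈ A, c n = δ) →
    ν (A ∩ {c | c (n + 1) = δ + 1}) = ν A * ENNReal.ofReal (upProb w δ)
  down : ∀ (n : ℕ) (A : Set (ℕ → ℤ)) (δ : ℤ), DeterminedBy A n → (∀ c ∈ A, c n = δ) →
    ν (A ∩ {c | c (n + 1) = δ - 1}) = ν A * ENNReal.ofReal (upProb w (-δ))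

/-- One-step transition law of the chain of local time differences. -/
def stackStep (w : ℤ → ℝ) (δ : ℤ) : Measure ℤ :=
  ENNReal.ofReal (upProb w δ) • Measure.dirac (δ + 1) +
    ENNReal.ofReal (upProb w (-δ)) • Measure.dirac (δ - 1)

theorem isProbabilityMeasure_stackStep {w : ℤ → ℝ} (hw : ∀ z, 0 < w z) (δ : ℤ) :
    IsProbabilityMeasure (stackStep w δ) :=
  ⟨by simp [stackStep, ofReal_upProb_add hw]⟩

theorem exists_isStackLaw {w : ℤ → ℝ} (hw : ∀ z, 0 < w z) :
    ∃ ν : Measure (ℕ → ℤ), IsProbabilityMeasure ν ∧ IsStackLaw w ν := by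
  let κ : (n : ℕ) → Kernel (Π _ : Finset.Iic n, ℤ) ℤ := fun n ↦
    Kernel.ofFunOfCountable fun h ↦ stackStep w (h ⟨n, by simp⟩)
  have hκ : ∀ n, IsMarkovKernel (κ n) := fun n ↦ ⟨fun h ↦ isProbabilityMeasure_stackStep hw _⟩
  let ν : Measure (ℕ → ℤ) := Kernel.trajMeasure (X := fun _ ↦ ℤ) (Measure.dirac 0) κ
  have hν : IsProbabilityMeasure ν := by infer_instance
  have key : ∀ (n : ℕ) (A : Set (ℕ → ℤ)) (δ δ' : ℤ), DeterminedBy A n → (∀ c ∈ A, c n = δ) →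
      ν (A ∩ {c | c (n + 1) = δ'}) = ν A * stackStep w δ {δ'} := by
    intro n A δ δ' hA hδ
    have hm : MeasurableSet (frestrictLe (π := fun _ ↦ ℤ) n '' A) :=
      (Set.to_countable _).measurableSet
    have h := congrArg (fun m ↦ m ((frestrictLe (π := fun _ ↦ ℤ) n '' A) ×ˢ {δ'}))
      (Kernel.map_frestrictLe_trajMeasure_compProd_eq_map_trajMeasure (X := fun _ ↦ ℤ)
      (μ₀ := Measure.dirac 0) (κ := κ) (a := n))
    simp only at h
    rw [Measure.compProd_apply_prod hm (MeasurableSet.singleton _),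
      Measure.map_apply (by fun_prop) (hm.prod (MeasurableSet.singleton _)),
      setLIntegral_congr_fun (g := fun _ ↦ stackStep w δ {δ'}) hm, setLIntegral_const,
      Measure.map_apply (by fun_prop) hm, ← hA.eq_preimage] at h
    · rw [mul_comm, h]
      congr 1
      ext c
      have := Set.ext_iff.1 hA.eq_preimage c
      simp only [Set.mem_preimage] at this
      simp [this]
    · rintro _ ⟨c, hc, rfl⟩
      have : c n = δ := hδ c hc
      simp [κ, Kernel.ofFunOfCountable, this]
  refine ⟨ν, hν, ?_, fun n A δ hA hδ ↦ ?_, fun n A δ hA hδ ↦ ?_⟩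
  · have h : ν.map (frestrictLe (π := fun _ ↦ ℤ) 0) =
        (Measure.dirac 0 : Measure ℤ).map
          (MeasurableEquiv.piUnique (fun _ : Finset.Iic 0 ↦ ℤ)).symm := by
      simp only [ν, Kernel.trajMeasure]
      rw [Measure.map_comp _ _ (by fun_prop), Kernel.traj_map_frestrictLe, Kernel.partialTraj_self,
        Measure.id_comp]
    have h0 : ∀ᵐ y ∂(ν.map (frestrictLe (π := fun _ ↦ ℤ) 0)), y ⟨0, by simp⟩ = 0 := by
      rw [h, ae_map_iff (by fun_prop) ((Set.to_countable _).measurableSet),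
        ae_dirac_iff ((Set.to_countable _).measurableSet)]
      simp [MeasurableEquiv.piUnique, Equiv.piUnique]
    exact ae_of_ae_map (by fun_prop) h0
  · rw [key n A δ _ hA hδ]
    simp [stackStep, show δ - 1 ≠ δ + 1 by lia]
  · rw [key n A δ _ hA hδ]
    simp [stackStep, show δ + 1 ≠ δ - 1 by lia]

/-- Number of up-steps among the first `n` steps of `c`. -/
def numUp (c : ℕ → ℤ) (n : ℕ) : ℕ := ((Finset.range n).filter fun i ↦ c (i + 1) = c i + 1).card

/-- Number of steps among the first `n` steps of `c` which are not up-steps. -/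
def numDown (c : ℕ → ℤ) (n : ℕ) : ℕ := ((Finset.range n).filter fun i ↦ c (i + 1) ≠ c i + 1).card

theorem numUp_succ (c : ℕ → ℤ) (n : ℕ) :
    numUp c (n + 1) = numUp c n + if c (n + 1) = c n + 1 then 1 else 0 := by
  unfold numUp
  rw [Finset.range_add_one, Finset.filter_insert]
  split_ifs <;> simp

theorem numDown_succ (c : ℕ → ℤ) (n : ℕ) :
    numDown c (n + 1) = numDown c n + if c (n + 1) = c n + 1 then 0 else 1 := by
  unfold numDown
  rw [Finset.range_add_one, Finset.filter_insert]
  split_ifs <;> simp_all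

theorem numUp_add_numDown (c : ℕ → ℤ) (n : ℕ) : numUp c n + numDown c n = n := by
  induction n with
  | zero => rfl
  | succ n ih =>
    rw [numUp_succ, numDown_succ]
    split_ifs <;> lia

theorem numDown_mono (c : ℕ → ℤ) : Monotone (numDown c) :=
  monotone_nat_of_le_succ fun n ↦ by rw [numDown_succ]; lia

theorem numUp_congr {c c' : ℕ → ℤ} {n : ℕ} (h : ∀ i ≤ n, c i = c' i) :
    numUp c n = numUp c' n := by
  unfold numUp
  congr 1
  refine Finset.filter_congr fun i hi ↦ ?_
  rw [Finset.mem_range] at hi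
  rw [h i hi.le, h (i + 1) hi]

theorem numDown_congr {c c' : ℕ → ℤ} {n : ℕ} (h : ∀ i ≤ n, c i = c' i) :
    numDown c n = numDown c' n := by
  have h1 := numUp_add_numDown c n
  have h2 := numUp_add_numDown c' n
  have h3 := numUp_congr h
  lia

/-- A nearest-neighbour trajectory started at `0`. -/
def IsNN (c : ℕ → ℤ) : Prop := c 0 = 0 ∧ ∀ n, c (n + 1) = c n + 1 ∨ c (n + 1) = c n - 1

theorem IsNN.eq_sub {c : ℕ → ℤ} (hc : IsNN c) (n : ℕ) :
    c n = (numUp c n : ℤ) - numDown c n := by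
  induction n with
  | zero => simp [hc.1, numUp, numDown]
  | succ n ih =>
    rw [numUp_succ, numDown_succ]
    rcases hc.2 n with h | h
    · rw [if_pos h, if_pos h]; push_cast; lia
    · rw [if_neg (by lia), if_neg (by lia)]; push_cast; lia

theorem determinedBy_coord (n : ℕ) (δ : ℤ) : DeterminedBy {c | c n = δ} n :=
  fun _ _ h hc ↦ (h n le_rfl).symm.trans hc

theorem IsStackLaw.ae_isNN {w : ℤ → ℝ} (hw : ∀ z, 0 < w z) {ν : Measure (ℕ → ℤ)}
    [IsProbabilityMeasure ν] (h : IsStackLaw w ν) : ∀ᵐ c ∂ν, IsNN c := by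
  refine h.zero.and (ae_all_iff.2 fun n ↦ ?_)
  have key : ∀ δ : ℤ, ∀ᵐ c ∂ν, c n = δ → (c (n + 1) = c n + 1 ∨ c (n + 1) = c n - 1) := by
    intro δ
    set A : Set (ℕ → ℤ) := {c | c n = δ}
    have hA : MeasurableSet A := (determinedBy_coord n δ).measurableSet
    have hm : ∀ δ' : ℤ, MeasurableSet {c : ℕ → ℤ | c (n + 1) = δ'} :=
      fun δ' ↦ (determinedBy_coord (n + 1) δ').measurableSet
    have hu := h.up n A δ (determinedBy_coord n δ) fun c hc ↦ hc
    have hd := h.down n A δ (determinedBy_coord n δ) fun c hc ↦ hc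
    have hdisj : Disjoint (A ∩ {c | c (n + 1) = δ + 1}) (A ∩ {c | c (n + 1) = δ - 1}) := by
      rw [Set.disjoint_left]
      rintro c ⟨-, h1⟩ ⟨-, h2⟩
      simp only [Set.mem_ofPred_eq] at h1 h2
      lia
    have hun := measure_union hdisj (hA.inter (hm (δ - 1))) (μ := ν)
    rw [hu, hd, ← mul_add, ofReal_upProb_add hw, mul_one] at hun
    have hdiff := measure_sdiff (μ := ν) (s₁ := A)
      (Set.union_subset (Set.inter_subset_left) (Set.inter_subset_left))
      ((hA.inter (hm (δ + 1))).union (hA.inter (hm (δ - 1)))).nullMeasurableSet (measure_ne_top _ _)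
    rw [hun, tsub_self] at hdiff
    refine measure_mono_null (fun c hc ↦ ?_) hdiff
    simp only [Set.mem_compl_iff, Set.mem_ofPred_eq, Classical.not_imp, not_or] at hc
    refine ⟨hc.1, ?_⟩
    rintro (h' | h')
    · exact hc.2.1 (by rw [h'.2, hc.1])
    · exact hc.2.2 (by rw [h'.2, hc.1])
  filter_upwards [ae_all_iff.2 key] with c hc using hc _ rfl

/-- The one-dimensional marginals of the chain of local time differences are symmetric. -/
theorem IsStackLaw.measure_neg {w : ℤ → ℝ} (hw : ∀ z, 0 < w z) {ν : Measure (ℕ → ℤ)}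
    [IsProbabilityMeasure ν] (h : IsStackLaw w ν) (n : ℕ) (δ : ℤ) :
    ν {c | c n = -δ} = ν {c | c n = δ} := by
  induction n generalizing δ with
  | zero =>
    refine measure_congr ?_
    filter_upwards [h.zero] with c hc
    refine propext ?_
    change c 0 = -δ ↔ c 0 = δ
    rw [hc]
    lia
  | succ n ih =>
    have key : ∀ δ : ℤ, ν {c | c (n + 1) = δ} =
        ν {c | c n = δ - 1} * ENNReal.ofReal (upProb w (δ - 1)) +
        ν {c | c n = δ + 1} * ENNReal.ofReal (upProb w (-(δ + 1))) := by
      intro δ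
      rw [← h.up n _ (δ - 1) (determinedBy_coord n _) fun c hc ↦ hc,
        ← h.down n _ (δ + 1) (determinedBy_coord n _) fun c hc ↦ hc, ← measure_union]
      · refine measure_congr ?_
        filter_upwards [h.ae_isNN hw] with c hc
        refine propext ?_
        change c (n + 1) = δ ↔ (c n = δ - 1 ∧ c (n + 1) = δ - 1 + 1) ∨
          (c n = δ + 1 ∧ c (n + 1) = δ + 1 - 1)
        rcases hc.2 n with h' | h' <;> lia
      · rw [Set.disjoint_left]
        rintro c ⟨h1, -⟩ ⟨h2, -⟩
        simp only [Set.mem_ofPred_eq] at h1 h2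
        lia
      · exact ((determinedBy_coord n _).measurableSet).inter
          (determinedBy_coord (n + 1) _).measurableSet
    rw [key, key, show -δ - 1 = -(δ + 1) by ring, show -δ + 1 = -(δ - 1) by ring, ih, ih, neg_neg,
      add_comm]

theorem sum_ite_numDown_le (c : ℕ → ℤ) (a n : ℕ) :
    ∑ i ∈ Finset.range n, (if c (i + 1) ≠ c i + 1 ∧ numDown c i < a then 1 else 0) =
      min (numDown c n) a := by
  induction n with
  | zero => simp [numDown]
  | succ n ih =>
    rw [Finset.sum_range_succ, ih, numDown_succ]
    split_ifs <;> simp_all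
    all_goals lia

/-- In expectation, at each time the chain steps up before its `a`-th down-step at most as often
as it steps down. -/
theorem IsStackLaw.measure_up_le_measure_down {w : ℤ → ℝ} (hw : ∀ z, 0 < w z) (hmono : Monotone w)
    {ν : Measure (ℕ → ℤ)} [IsProbabilityMeasure ν] (h : IsStackLaw w ν) (a n : ℕ) :
    ν {c | c (n + 1) = c n + 1 ∧ numDown c n < a} ≤
      ν {c | c (n + 1) ≠ c n + 1 ∧ numDown c n < a} := by
  have hpart : ∀ s : Set (ℕ → ℤ), MeasurableSet s → ν s = ∑' δ : ℤ, ν ({c | c n = δ} ∩ s) := by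
    intro s hs
    rw [← measure_iUnion]
    · congr 1
      ext c
      simp
    · intro δ δ' hne
      rw [Function.onFun, Set.disjoint_left]
      rintro c ⟨h1, -⟩ ⟨h2, -⟩
      exact hne (h1.symm.trans h2)
    · exact fun δ ↦ (determinedBy_coord n δ).measurableSet.inter hs
  have hmeas : ∀ p : Prop → Prop, MeasurableSet
      {c : ℕ → ℤ | p (c (n + 1) = c n + 1) ∧ numDown c n < a} := fun p ↦
    DeterminedBy.measurableSet (n := n + 1) fun c c' hcc hc ↦ by
      have e := numDown_congr (n := n) (fun i hi ↦ hcc i (by lia))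
      simp only [Set.mem_ofPred_eq] at hc ⊢
      rwa [← e, ← hcc n (by lia), ← hcc (n + 1) le_rfl]
  set m : ℤ → ℝ≥0∞ := fun δ ↦ ν {c | c n = δ}
  set I : ℤ → ℝ≥0∞ := fun δ ↦ if (n : ℤ) < 2 * a + δ then 1 else 0
  set q : ℤ → ℝ≥0∞ := fun δ ↦ ENNReal.ofReal (upProb w δ)
  have hsymm : ∀ δ, m (-δ) = m δ := h.measure_neg hw n
  have hdown : ∀ c, IsNN c → (numDown c n < a ↔ (n : ℤ) < 2 * a + c n) := by
    intro c hc
    have h1 := hc.eq_sub n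
    have h2 := numUp_add_numDown c n
    lia
  have hU : ν {c | c (n + 1) = c n + 1 ∧ numDown c n < a} = ∑' δ, m δ * I δ * q δ := by
    rw [hpart _ (hmeas fun p ↦ p)]
    refine tsum_congr fun δ ↦ ?_
    by_cases hI : (n : ℤ) < 2 * a + δ
    · simp only [I, if_pos hI, mul_one, m, q]
      rw [← h.up n _ δ (determinedBy_coord n _) fun c hc ↦ hc]
      refine measure_congr ?_
      filter_upwards [h.ae_isNN hw] with c hc
      refine propext ?_
      change (c n = δ ∧ c (n + 1) = c n + 1 ∧ numDown c n < a) ↔ (c n = δ ∧ c (n + 1) = δ + 1)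
      rw [hdown c hc]
      constructor
      · rintro ⟨rfl, h1, -⟩; exact ⟨rfl, h1⟩
      · rintro ⟨rfl, h1⟩; exact ⟨rfl, h1, hI⟩
    · simp only [I, if_neg hI, mul_zero, zero_mul]
      refine measure_eq_zero_iff_ae_notMem.2 ?_
      filter_upwards [h.ae_isNN hw] with c hc
      rintro ⟨rfl, -, h1⟩
      exact hI ((hdown c hc).1 h1)
  have hD : ν {c | c (n + 1) ≠ c n + 1 ∧ numDown c n < a} = ∑' δ, m δ * I δ * q (-δ) := by
    rw [hpart _ (hmeas Not)]
    refine tsum_congr fun δ ↦ ?_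
    by_cases hI : (n : ℤ) < 2 * a + δ
    · simp only [I, if_pos hI, mul_one, m, q]
      rw [← h.down n _ δ (determinedBy_coord n _) fun c hc ↦ hc]
      refine measure_congr ?_
      filter_upwards [h.ae_isNN hw] with c hc
      refine propext ?_
      change (c n = δ ∧ c (n + 1) ≠ c n + 1 ∧ numDown c n < a) ↔ (c n = δ ∧ c (n + 1) = δ - 1)
      rw [hdown c hc]
      have h2 := hc.2 n
      constructor
      · rintro ⟨rfl, h1, -⟩; exact ⟨rfl, by lia⟩
      · rintro ⟨rfl, h1⟩; exact ⟨rfl, by lia, hI⟩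
    · simp only [I, if_neg hI, mul_zero, zero_mul]
      refine measure_eq_zero_iff_ae_notMem.2 ?_
      filter_upwards [h.ae_isNN hw] with c hc
      rintro ⟨rfl, -, h1⟩
      exact hI ((hdown c hc).1 h1)
  have hq : ∀ δ, 0 ≤ δ → q δ ≤ q (-δ) := fun δ hδ ↦
    ENNReal.ofReal_le_ofReal (upProb_le_upProb_neg hw hmono hδ)
  have hfold : ∀ f : ℤ → ℝ≥0∞, 2 * ∑' δ, f δ = ∑' δ, (f δ + f (-δ)) := by
    intro f
    have e := (Equiv.neg ℤ).tsum_eq f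
    simp only [Equiv.neg_apply] at e
    rw [ENNReal.tsum_add, e, two_mul]
  rw [hU, hD, ← ENNReal.mul_le_mul_iff_right two_ne_zero (by simp), hfold, hfold]
  refine ENNReal.tsum_le_tsum fun δ ↦ ?_
  rw [hsymm, neg_neg, mul_assoc, mul_assoc, mul_assoc, mul_assoc, ← mul_add, ← mul_add]
  refine mul_le_mul' le_rfl ?_
  have hI : ∀ δ, I δ = if (n : ℤ) < 2 * a + δ then 1 else 0 := fun _ ↦ rfl
  rw [hI, hI]
  split_ifs with h1 h2 h2 <;> simp only [one_mul, zero_mul, add_zero, zero_add, le_refl]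
  · exact (add_comm _ _).le
  · exact hq δ (by lia)
  · have := hq (-δ) (by lia)
    rwa [neg_neg] at this

/-- Total number of up-steps of `c` which are preceded by fewer than `a` down-steps. -/
def upTotal (c : ℕ → ℤ) (a : ℕ) : ℝ≥0∞ :=
  ∑' i, if c (i + 1) = c i + 1 ∧ numDown c i < a then 1 else 0

theorem measurableSet_step (p : Prop → Prop) (a n : ℕ) :
    MeasurableSet {c : ℕ → ℤ | p (c (n + 1) = c n + 1) ∧ numDown c n < a} :=
  DeterminedBy.measurableSet (n := n + 1) fun c c' hcc hc ↦ by
    have e := numDown_congr (n := n) (fun i hi ↦ hcc i (by lia))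
    simp only [Set.mem_ofPred_eq] at hc ⊢
    rwa [← e, ← hcc n (by lia), ← hcc (n + 1) le_rfl]

theorem measurable_upTotal (a : ℕ) : Measurable fun c ↦ upTotal c a :=
  Measurable.tsum fun n ↦
    Measurable.ite (measurableSet_step (fun p ↦ p) a n) measurable_const measurable_const

theorem lintegral_tsum_ite {α : Type*} [MeasurableSpace α] (μ : Measure α) (p : ℕ → α → Prop)
    [∀ n, DecidablePred (p n)] (hp : ∀ n, MeasurableSet {c | p n c}) :
    ∫⁻ c, ∑' n, (if p n c then 1 else 0) ∂μ = ∑' n, μ {c | p n c} := by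
  rw [lintegral_tsum fun n ↦ (Measurable.ite (hp n) measurable_const measurable_const).aemeasurable]
  refine tsum_congr fun n ↦ ?_
  rw [← lintegral_indicator_one (hp n)]
  refine lintegral_congr fun c ↦ ?_
  rw [Set.indicator_apply]
  rfl

theorem IsStackLaw.lintegral_upTotal_le {w : ℤ → ℝ} (hw : ∀ z, 0 < w z) (hmono : Monotone w)
    {ν : Measure (ℕ → ℤ)} [IsProbabilityMeasure ν] (h : IsStackLaw w ν) (a : ℕ) :
    ∫⁻ c, upTotal c a ∂ν ≤ a := by
  calc ∫⁻ c, upTotal c a ∂ν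
      = ∑' n, ν {c | c (n + 1) = c n + 1 ∧ numDown c n < a} := by
        exact lintegral_tsum_ite ν _ fun n ↦ measurableSet_step (fun p ↦ p) a n
    _ ≤ ∑' n, ν {c | c (n + 1) ≠ c n + 1 ∧ numDown c n < a} :=
        ENNReal.tsum_le_tsum fun n ↦ h.measure_up_le_measure_down hw hmono a n
    _ = ∫⁻ c, ∑' n, (if c (n + 1) ≠ c n + 1 ∧ numDown c n < a then 1 else 0) ∂ν := by
        exact (lintegral_tsum_ite ν _ fun n ↦ measurableSet_step Not a n).symm
    _ ≤ ∫⁻ _, a ∂ν := by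
        refine lintegral_mono fun c ↦ ENNReal.tsum_le_of_sum_range_le fun n ↦ ?_
        have e := sum_ite_numDown_le c a n
        have e' : ∑ i ∈ Finset.range n,
            (if c (i + 1) ≠ c i + 1 ∧ numDown c i < a then (1 : ℝ≥0∞) else 0) =
            ((min (numDown c n) a : ℕ) : ℝ≥0∞) := by
          rw [← e]
          push_cast
          rfl
        rw [e']
        exact_mod_cast min_le_right _ _
    _ = a := by simp

/-- Natural number version of `upTotal`. -/
def overshoot (c : ℕ → ℤ) (a : ℕ) : ℕ := ⌊(upTotal c a).toReal⌋₊

theorem measurable_overshoot (a : ℕ) : Measurable fun c ↦ overshoot c a :=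
  Nat.measurable_floor.comp (measurable_upTotal a).ennreal_toReal

theorem overshoot_le_upTotal (c : ℕ → ℤ) (a : ℕ) : (overshoot c a : ℝ≥0∞) ≤ upTotal c a := by
  rcases eq_or_ne (upTotal c a) ∞ with h | h
  · rw [h]; exact le_top
  · rw [← ENNReal.ofReal_toReal h, ← ENNReal.ofReal_natCast]
    refine ENNReal.ofReal_le_ofReal ?_
    exact Nat.floor_le ENNReal.toReal_nonneg

theorem numUp_le_overshoot {c : ℕ → ℤ} {a : ℕ} (hc : upTotal c a ≠ ∞) {n : ℕ}
    (h : ∀ i < n, c (i + 1) = c i + 1 → numDown c i < a) : numUp c n ≤ overshoot c a := by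
  have h1 : (numUp c n : ℝ≥0∞) ≤ upTotal c a := by
    refine le_trans (le_of_eq ?_) (ENNReal.sum_le_tsum (Finset.range n))
    unfold numUp
    rw [Finset.card_filter]
    push_cast
    refine Finset.sum_congr rfl fun i hi ↦ ?_
    have := h i (Finset.mem_range.1 hi)
    by_cases h' : c (i + 1) = c i + 1
    · rw [if_pos h', if_pos ⟨h', this h'⟩]
    · rw [if_neg h', if_neg fun h'' ↦ h' h''.1]
  refine Nat.le_floor ?_
  rw [← ENNReal.toReal_natCast]
  exact ENNReal.toReal_mono hc h1

theorem overshoot_eq_zero {c : ℕ → ℤ} {a : ℕ} (h : ∀ i ≤ a, c i = -i) : overshoot c a = 0 := by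
  have hd : ∀ i ≤ a, numDown c i = i := by
    intro i hi
    induction i with
    | zero => rfl
    | succ i ih =>
      rw [numDown_succ, ih (by lia), if_neg]
      have h1 := h i (by lia)
      have h2 := h (i + 1) hi
      push_cast at h2
      lia
  have : upTotal c a = 0 := by
    unfold upTotal
    rw [ENNReal.tsum_eq_zero]
    intro i
    rw [if_neg]
    rintro ⟨h1, h2⟩
    by_cases hi : i < a
    · have h3 := h i (by lia)
      have h4 := h (i + 1) (by lia)
      push_cast at h4
      lia
    · have := numDown_mono c (show a ≤ i by lia)
      rw [hd a le_rfl] at this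
      lia
  simp [overshoot, this]

/-- The trajectories whose first `M` steps all go down. -/
def downFirst (M : ℕ) : Set (ℕ → ℤ) := {c | ∀ i ≤ M, c i = -i}

theorem determinedBy_downFirst (M : ℕ) : DeterminedBy (downFirst M) M :=
  fun _ _ h hc i hi ↦ (h i hi).symm.trans (hc i hi)

theorem IsStackLaw.measure_downFirst_pos {w : ℤ → ℝ} (hw : ∀ z, 0 < w z)
    {ν : Measure (ℕ → ℤ)} [IsProbabilityMeasure ν] (h : IsStackLaw w ν) (M : ℕ) :
    0 < ν (downFirst M) := by
  induction M with
  | zero =>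
    have : ν (downFirst 0) = ν Set.univ := by
      refine measure_congr ?_
      filter_upwards [h.zero] with c hc
      refine propext ⟨fun _ ↦ trivial, fun _ i hi ↦ ?_⟩
      obtain rfl : i = 0 := by lia
      simpa using hc
    rw [this]
    simp
  | succ M ih =>
    have hd := h.down M (downFirst M) (-M) (determinedBy_downFirst M) fun c hc ↦ hc M le_rfl
    have : downFirst M ∩ {c | c (M + 1) = -M - 1} ⊆ downFirst (M + 1) := by
      rintro c ⟨h1, h2⟩ i hi
      rcases Nat.lt_or_ge M i with h' | h'
      · obtain rfl : i = M + 1 := by lia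
        rw [h2]
        push_cast
        ring
      · exact h1 i h'
    refine lt_of_lt_of_le ?_ (measure_mono this)
    rw [hd]
    exact ENNReal.mul_pos ih.ne' (ENNReal.ofReal_pos.2 (upProb_pos hw _)).ne'

theorem overshoot_zero (c : ℕ → ℤ) : overshoot c 0 = 0 := by
  simp [overshoot, upTotal]

/-- The branching-type process which dominates the numbers of traversals of the edges to the right
of the origin, started from `r` and driven by the environment `ω`. -/
def edgeChain (r : ℕ) (ω : ℤ → ℕ → ℤ) : ℕ → ℕ
  | 0 => r
  | k + 1 => overshoot (ω (k + 1)) (edgeChain r ω k)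

theorem measurable_overshoot_uncurry : Measurable fun p : (ℕ → ℤ) × ℕ ↦ overshoot p.1 p.2 :=
  measurable_from_prod_countable_left fun a ↦ measurable_overshoot a

@[fun_prop]
theorem measurable_edgeChain (r k : ℕ) : Measurable fun ω ↦ edgeChain r ω k := by
  induction k with
  | zero => exact measurable_const
  | succ k ih =>
    exact measurable_overshoot_uncurry.comp ((measurable_pi_apply ((k : ℤ) + 1)).prodMk ih)

theorem edgeChain_congr {r k : ℕ} {ω ω' : ℤ → ℕ → ℤ} (h : ∀ i ∈ Finset.Icc (1 : ℤ) k, ω i = ω' i) :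
    edgeChain r ω k = edgeChain r ω' k := by
  induction k with
  | zero => rfl
  | succ k ih =>
    simp only [Finset.mem_Icc] at h ih
    rw [edgeChain, edgeChain, ih fun i hi ↦ h i ⟨hi.1, by push_cast; lia⟩,
      h _ ⟨by lia, by push_cast; lia⟩]

theorem indepFun_edgeChain (ν : Measure (ℕ → ℤ)) [IsProbabilityMeasure ν] (r k : ℕ) :
    IndepFun (fun ω : ℤ → ℕ → ℤ ↦ ω (k + 1)) (fun ω ↦ edgeChain r ω k)
      (Measure.infinitePi fun _ ↦ ν) := by
  have h := (iIndepFun_infinitePi (P := fun _ : ℤ ↦ ν) (X := fun _ c ↦ c)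
    (fun _ ↦ measurable_id)).indepFun_finset {(k : ℤ) + 1} (Finset.Icc 1 (k : ℤ))
    (by simp) (fun i ↦ measurable_pi_apply i)
  let e : (Finset.Icc 1 (k : ℤ) → ℕ → ℤ) → ℤ → ℕ → ℤ :=
    fun y i ↦ if hi : i ∈ Finset.Icc 1 (k : ℤ) then y ⟨i, hi⟩ else 0
  have he : Measurable e := by
    refine measurable_pi_lambda _ fun i ↦ ?_
    by_cases hi : i ∈ Finset.Icc 1 (k : ℤ)
    · simp only [e, dif_pos hi]
      exact measurable_pi_apply _
    · simp only [e, dif_neg hi]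
      exact measurable_const
  have hφ : Measurable fun y : ({(k : ℤ) + 1} : Finset ℤ) → ℕ → ℤ ↦ y ⟨(k : ℤ) + 1, by simp⟩ :=
    measurable_pi_apply _
  have h2 := h.comp (φ := fun y ↦ y ⟨(k : ℤ) + 1, by simp⟩) (ψ := fun y ↦ edgeChain r (e y) k)
    hφ ((measurable_edgeChain r k).comp he)
  have h3 : (fun ω ↦ edgeChain r ω k) = (fun y ↦ edgeChain r (e y) k) ∘
      fun (ω : ℤ → ℕ → ℤ) (i : Finset.Icc 1 (k : ℤ)) ↦ ω i := by
    funext ω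
    refine edgeChain_congr fun i hi ↦ ?_
    simp only [e, dif_pos hi]
  rw [h3]
  exact h2

theorem IsStackLaw.lintegral_edgeChain_le {w : ℤ → ℝ} (hw : ∀ z, 0 < w z) (hmono : Monotone w)
    {ν : Measure (ℕ → ℤ)} [IsProbabilityMeasure ν] (h : IsStackLaw w ν) (r k : ℕ) :
    ∫⁻ ω, (edgeChain r ω k : ℝ≥0∞) ∂(Measure.infinitePi fun _ : ℤ ↦ ν) ≤ r := by
  induction k with
  | zero => simp [edgeChain]
  | succ k ih =>
    refine le_trans ?_ ih
    set Q := Measure.infinitePi fun _ : ℤ ↦ ν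
    have hmap := (indepFun_iff_map_prod_eq_prod_map_map (measurable_pi_apply _).aemeasurable (by fun_prop)).1
      (indepFun_edgeChain ν r k)
    have hg : Measurable fun p : (ℕ → ℤ) × ℕ ↦ (overshoot p.1 p.2 : ℝ≥0∞) :=
      (measurable_from_top (f := fun n : ℕ ↦ (n : ℝ≥0∞))).comp measurable_overshoot_uncurry
    have hν : Q.map (fun ω ↦ ω (k + 1)) = ν := Measure.infinitePi_map_eval (fun _ : ℤ ↦ ν) _
    have : IsProbabilityMeasure (Q.map fun ω ↦ edgeChain r ω k) :=
      Measure.isProbabilityMeasure_map (by fun_prop)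
    calc ∫⁻ ω, (edgeChain r ω (k + 1) : ℝ≥0∞) ∂Q
        = ∫⁻ p, (overshoot p.1 p.2 : ℝ≥0∞) ∂(Q.map fun ω ↦ (ω (k + 1), edgeChain r ω k)) := by
          rw [lintegral_map hg (by fun_prop)]
          rfl
      _ = ∫⁻ a, ∫⁻ c, (overshoot c a : ℝ≥0∞) ∂ν ∂(Q.map fun ω ↦ edgeChain r ω k) := by
          rw [hmap, hν, lintegral_prod_symm _ hg.aemeasurable]
      _ ≤ ∫⁻ a, (a : ℝ≥0∞) ∂(Q.map fun ω ↦ edgeChain r ω k) :=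
          lintegral_mono fun a ↦ (lintegral_mono fun c ↦ overshoot_le_upTotal c a).trans
            (h.lintegral_upTotal_le hw hmono a)
      _ = ∫⁻ ω, (edgeChain r ω k : ℝ≥0∞) ∂Q := by
          rw [lintegral_map measurable_from_top (by fun_prop)]

theorem IsStackLaw.ae_exists_edgeChain_eq_zero {w : ℤ → ℝ} (hw : ∀ z, 0 < w z)
    (hmono : Monotone w) {ν : Measure (ℕ → ℤ)} [IsProbabilityMeasure ν] (h : IsStackLaw w ν) (r : ℕ) :
    ∀ᵐ ω ∂(Measure.infinitePi fun _ : ℤ ↦ ν), ∃ k, edgeChain r ω k = 0 := by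
  set Q := Measure.infinitePi fun _ : ℤ ↦ ν
  set α := Q {ω | ¬ ∃ k, edgeChain r ω k = 0} with hα
  change α = 0
  by_contra hne
  obtain ⟨M, hM⟩ := ENNReal.exists_nat_mul_gt hne (ENNReal.natCast_ne_top r)
  have hS : ∀ p : ℕ → Prop, ∀ k, MeasurableSet {ω | p (edgeChain r ω k)} := fun p k ↦
    measurable_edgeChain r k (MeasurableSet.of_discrete (s := {n | p n}))
  have hbig : ∀ k, Q {ω | M + 1 ≤ edgeChain r ω k} ≤ r / (M + 1) := by
    intro k
    have h1 := meas_ge_le_lintegral_div (μ := Q) (f := fun ω ↦ (edgeChain r ω k : ℝ≥0∞))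
      (ε := M + 1) ((measurable_from_top (f := fun n : ℕ ↦ (n : ℝ≥0∞))).comp
        (measurable_edgeChain r k)).aemeasurable (by simp) (by finiteness)
    refine le_trans (le_trans (measure_mono fun ω hω ↦ ?_) h1)
      (ENNReal.div_le_div_right (h.lintegral_edgeChain_le hw hmono r k) _)
    change (M + 1 : ℝ≥0∞) ≤ (edgeChain r ω k : ℝ≥0∞)
    exact_mod_cast hω
  have hb : (r / (M + 1) : ℝ≥0∞) < α := by
    rw [ENNReal.div_lt_iff (Or.inl (by simp)) (Or.inl (by finiteness)), mul_comm]
    refine hM.trans_le ?_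
    gcongr
    exact le_self_add
  set ε := ν (downFirst M) * (α - r / (M + 1)) with hε
  have hε0 : ε ≠ 0 := mul_ne_zero (h.measure_downFirst_pos hw M).ne' (tsub_pos_of_lt hb).ne'
  have hstep : ∀ k, Q {ω | 1 ≤ edgeChain r ω (k + 1)} + ε ≤ Q {ω | 1 ≤ edgeChain r ω k} := by
    intro k
    have hmid : α - r / (M + 1) ≤ Q {ω | 1 ≤ edgeChain r ω k ∧ edgeChain r ω k ≤ M} := by
      rw [tsub_le_iff_right]
      refine le_trans ?_ (add_le_add le_rfl (hbig k))
      refine le_trans (measure_mono fun ω hω ↦ ?_) (measure_union_le _ _)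
      simp only [Set.mem_ofPred_eq, not_exists] at hω
      have := hω k
      simp only [Set.mem_union, Set.mem_ofPred_eq]
      lia
    have hprod : Q ({ω | ω (k + 1) ∈ downFirst M} ∩
        {ω | 1 ≤ edgeChain r ω k ∧ edgeChain r ω k ≤ M}) =
        ν (downFirst M) * Q {ω | 1 ≤ edgeChain r ω k ∧ edgeChain r ω k ≤ M} := by
      have h1 := (indepFun_edgeChain ν r k).measure_inter_preimage_eq_mul (downFirst M)
        {n | 1 ≤ n ∧ n ≤ M} (determinedBy_downFirst M).measurableSet .of_discrete
      have hν : Q.map (fun ω ↦ ω (k + 1)) = ν := Measure.infinitePi_map_eval (fun _ : ℤ ↦ ν) _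
      rw [← hν, Measure.map_apply (by fun_prop) (determinedBy_downFirst M).measurableSet]
      exact h1
    calc Q {ω | 1 ≤ edgeChain r ω (k + 1)} + ε
        ≤ Q {ω | 1 ≤ edgeChain r ω (k + 1)} + Q ({ω | ω (k + 1) ∈ downFirst M} ∩
            {ω | 1 ≤ edgeChain r ω k ∧ edgeChain r ω k ≤ M}) := by
          rw [hprod, hε]
          gcongr
      _ = Q ({ω | 1 ≤ edgeChain r ω (k + 1)} ∪ ({ω | ω (k + 1) ∈ downFirst M} ∩
            {ω | 1 ≤ edgeChain r ω k ∧ edgeChain r ω k ≤ M})) := by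
          rw [measure_union' _ (hS (1 ≤ ·) (k + 1))]
          rw [Set.disjoint_left]
          rintro ω h1 ⟨h2, h3⟩
          have : edgeChain r ω (k + 1) = 0 := overshoot_eq_zero fun i hi ↦ h2 i (hi.trans h3.2)
          simp only [Set.mem_ofPred_eq] at h1
          lia
      _ ≤ Q {ω | 1 ≤ edgeChain r ω k} := by
          refine measure_mono ?_
          rintro ω (h1 | h1)
          · simp only [Set.mem_ofPred_eq] at h1 ⊢
            by_contra h2
            have h3 : edgeChain r ω k = 0 := by lia
            rw [edgeChain, h3, overshoot_zero] at h1
            lia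
          · exact h1.2.1
  have hsum : ∀ k : ℕ, Q {ω | 1 ≤ edgeChain r ω k} + k * ε ≤ 1 := by
    intro k
    induction k with
    | zero => simpa using prob_le_one
    | succ k ih =>
      refine le_trans ?_ ih
      push_cast
      calc _ = (Q {ω | 1 ≤ edgeChain r ω (k + 1)} + ε) + k * ε := by ring
        _ ≤ _ := add_le_add (hstep k) le_rfl
  obtain ⟨n, hn⟩ := ENNReal.exists_nat_mul_gt hε0 ENNReal.one_ne_top
  exact absurd (le_trans le_add_self (hsum n)) (not_le.2 hn)

theorem dirLocP_succ (x : ℕ → ℤ) (n : ℕ) (k : ℤ) :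
    dirLocP x (n + 1) k = dirLocP x n k + if x n = k ∧ x (n + 1) = k + 1 then 1 else 0 := by
  unfold dirLocP
  rw [Finset.range_add_one, Finset.filter_insert]
  split_ifs <;> simp

theorem dirLocM_succ (x : ℕ → ℤ) (n : ℕ) (k : ℤ) :
    dirLocM x (n + 1) k = dirLocM x n k + if x n = k ∧ x (n + 1) = k - 1 then 1 else 0 := by
  unfold dirLocM
  rw [Finset.range_add_one, Finset.filter_insert]
  split_ifs <;> simp

theorem dirLocP_congr {x y : ℕ → ℤ} {n : ℕ} (h : ∀ i ≤ n, x i = y i) (k : ℤ) :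
    dirLocP x n k = dirLocP y n k := by
  unfold dirLocP
  congr 1
  refine Finset.filter_congr fun i hi ↦ ?_
  rw [Finset.mem_range] at hi
  rw [h i hi.le, h (i + 1) hi]

theorem dirLocM_congr {x y : ℕ → ℤ} {n : ℕ} (h : ∀ i ≤ n, x i = y i) (k : ℤ) :
    dirLocM x n k = dirLocM y n k := by
  unfold dirLocM
  congr 1
  refine Finset.filter_congr fun i hi ↦ ?_
  rw [Finset.mem_range] at hi
  rw [h i hi.le, h (i + 1) hi]

/-- Number of nearest-neighbour steps out of `k` before time `n`. -/
def departures (x : ℕ → ℤ) (n : ℕ) (k : ℤ) : ℕ := dirLocP x n k + dirLocM x n k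

theorem departures_succ (x : ℕ → ℤ) (n : ℕ) (k : ℤ) :
    departures x (n + 1) k =
      departures x n k + if x n = k ∧ (x (n + 1) = k + 1 ∨ x (n + 1) = k - 1) then 1 else 0 := by
  unfold departures
  rw [dirLocP_succ, dirLocM_succ]
  split_ifs <;> lia

theorem departures_mono (x : ℕ → ℤ) (k : ℤ) : Monotone fun n ↦ departures x n k :=
  monotone_nat_of_le_succ fun n ↦ by rw [departures_succ]; lia

theorem departures_congr {x y : ℕ → ℤ} {n : ℕ} (h : ∀ i ≤ n, x i = y i) (k : ℤ) :
    departures x n k = departures y n k := by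
  unfold departures
  rw [dirLocP_congr h, dirLocM_congr h]

/-- Position and numbers of departures of the walk which at its `v`-th departure from `k` follows
the `v`-th step of `ω k`. -/
def stackState (ω : ℤ → ℕ → ℤ) : ℕ → ℤ × (ℤ → ℕ)
  | 0 => (0, 0)
  | n + 1 =>
    let s := stackState ω n
    (if ω s.1 (s.2 s.1 + 1) = ω s.1 (s.2 s.1) + 1 then s.1 + 1 else s.1 - 1,
      Function.update s.2 s.1 (s.2 s.1 + 1))

/-- The walk which at its `v`-th departure from `k` follows the `v`-th step of `ω k`. -/
def stackWalk (ω : ℤ → ℕ → ℤ) (n : ℕ) : ℤ := (stackState ω n).1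

theorem stackState_snd (ω : ℤ → ℕ → ℤ) (n : ℕ) (k : ℤ) :
    (stackState ω n).2 k = departures (stackWalk ω) n k := by
  induction n with
  | zero => simp [stackState, departures, dirLocP, dirLocM]
  | succ n ih =>
    have h : stackWalk ω (n + 1) = stackWalk ω n + 1 ∨ stackWalk ω (n + 1) = stackWalk ω n - 1 := by
      simp only [stackWalk, stackState]
      split_ifs <;> simp
    rw [departures_succ, ← ih]
    simp only [stackState, Function.update_apply]
    change (if k = stackWalk ω n then (stackState ω n).2 (stackWalk ω n) + 1 else _) = _
    split_ifs with h1 h2 h2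
    · rw [h1]
    · lia
    · lia
    · rfl

theorem stackWalk_zero (ω : ℤ → ℕ → ℤ) : stackWalk ω 0 = 0 := rfl

theorem stackWalk_succ (ω : ℤ → ℕ → ℤ) (n : ℕ) :
    stackWalk ω (n + 1) = if ω (stackWalk ω n) (departures (stackWalk ω) n (stackWalk ω n) + 1) =
      ω (stackWalk ω n) (departures (stackWalk ω) n (stackWalk ω n)) + 1 then stackWalk ω n + 1
      else stackWalk ω n - 1 := by
  rw [← stackState_snd]
  rfl

theorem isNN_stackWalk (ω : ℤ → ℕ → ℤ) : IsNN (stackWalk ω) := by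
  refine ⟨rfl, fun n ↦ ?_⟩
  rw [stackWalk_succ]
  split_ifs <;> simp

theorem dirLocP_stackWalk (ω : ℤ → ℕ → ℤ) (n : ℕ) (k : ℤ) :
    dirLocP (stackWalk ω) n k = numUp (ω k) (departures (stackWalk ω) n k) := by
  induction n with
  | zero => rfl
  | succ n ih =>
    have h := stackWalk_succ ω n
    have h' := (isNN_stackWalk ω).2 n
    rw [dirLocP_succ, departures_succ, ih]
    by_cases hk : stackWalk ω n = k
    · rw [hk] at h h'
      rw [if_pos (c := _ ∧ _ ) ⟨hk, h'⟩, numUp_succ]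
      split_ifs at h ⊢ <;> lia
    · rw [if_neg (by tauto), if_neg (by tauto)]
      rfl

theorem dirLocM_stackWalk (ω : ℤ → ℕ → ℤ) (n : ℕ) (k : ℤ) :
    dirLocM (stackWalk ω) n k = numDown (ω k) (departures (stackWalk ω) n k) := by
  have h1 := dirLocP_stackWalk ω n k
  have h2 := numUp_add_numDown (ω k) (departures (stackWalk ω) n k)
  have h3 : departures (stackWalk ω) n k =
    dirLocP (stackWalk ω) n k + dirLocM (stackWalk ω) n k := rfl
  lia

theorem measurable_stackState (n : ℕ) : Measurable fun ω ↦ stackState ω n := by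
  induction n with
  | zero => exact measurable_const
  | succ n ih =>
    have hv : Measurable fun ω ↦ (stackState ω n).2 (stackState ω n).1 :=
      (measurable_from_prod_countable_left (f := fun p : (ℤ → ℕ) × ℤ ↦ p.1 p.2)
        fun k ↦ measurable_pi_apply k).comp (ih.snd.prodMk ih.fst)
    have hstep : Measurable fun p : (ℤ → ℕ → ℤ) × (ℤ × ℕ) ↦
        if p.1 p.2.1 (p.2.2 + 1) = p.1 p.2.1 p.2.2 + 1 then p.2.1 + 1 else p.2.1 - 1 := by
      refine measurable_from_prod_countable_left fun q ↦ ?_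
      have hm : ∀ v, Measurable fun ω : ℤ → ℕ → ℤ ↦ ω q.1 v := fun v ↦
        (measurable_pi_apply v).comp (measurable_pi_apply q.1)
      exact Measurable.ite (measurableSet_eq_fun (hm (q.2 + 1)) ((hm q.2).add_const 1))
        (measurable_const (a := q.1 + 1)) (measurable_const (a := q.1 - 1))
    refine Measurable.prodMk (hstep.comp (measurable_id.prodMk (ih.fst.prodMk hv))) ?_
    refine measurable_pi_lambda _ fun k ↦ ?_
    simp only [Function.update_apply]
    exact Measurable.ite (measurableSet_eq_fun measurable_const ih.fst) (hv.add_const 1)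
      ((measurable_pi_apply k).comp ih.snd)

theorem measurable_stackWalk (n : ℕ) : Measurable fun ω ↦ stackWalk ω n :=
  (measurable_stackState n).fst

/-- The trajectories at site `k` which are compatible with the first `n` steps of the path `x`. -/
def siteBox (x : ℕ → ℤ) (n : ℕ) (k : ℤ) : Set (ℕ → ℤ) :=
  {c | ∀ i < n, x i = k →
    (x (i + 1) = k + 1 ∧ c (departures x i k + 1) = c (departures x i k) + 1) ∨
    (x (i + 1) = k - 1 ∧ c (departures x i k + 1) ≠ c (departures x i k) + 1)}

theorem mem_siteBox_succ {x : ℕ → ℤ} {n : ℕ} {k : ℤ} {c : ℕ → ℤ} :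
    c ∈ siteBox x (n + 1) k ↔ c ∈ siteBox x n k ∧ (x n = k →
      (x (n + 1) = k + 1 ∧ c (departures x n k + 1) = c (departures x n k) + 1) ∨
      (x (n + 1) = k - 1 ∧ c (departures x n k + 1) ≠ c (departures x n k) + 1)) := by
  simp only [siteBox, Set.mem_ofPred_eq]
  constructor
  · exact fun h ↦ ⟨fun i hi ↦ h i (by lia), h n (by lia)⟩
  · rintro ⟨h1, h2⟩ i hi
    rcases Nat.lt_succ_iff_lt_or_eq.1 hi with h | rfl
    · exact h1 i h
    · exact h2

theorem determinedBy_siteBox (x : ℕ → ℤ) (n : ℕ) (k : ℤ) :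
    DeterminedBy (siteBox x n k) (departures x n k) := by
  intro c c' hcc hc i hi hk
  have h1 := hc i hi hk
  have h2 : departures x i k + 1 ≤ departures x n k := by
    refine le_trans ?_ (departures_mono x k (show i + 1 ≤ n from hi))
    change _ ≤ departures x (i + 1) k
    rw [departures_succ, if_pos ⟨hk, by tauto⟩]
  rwa [← hcc _ h2, ← hcc _ (by lia)]

theorem numUp_of_mem_siteBox {x : ℕ → ℤ} {n : ℕ} {k : ℤ} {c : ℕ → ℤ} (hc : c ∈ siteBox x n k) :
    numUp c (departures x n k) = dirLocP x n k := by
  induction n with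
  | zero => rfl
  | succ n ih =>
    rw [mem_siteBox_succ] at hc
    rw [departures_succ, dirLocP_succ, ← ih hc.1]
    by_cases hk : x n = k
    · rcases hc.2 hk with ⟨h1, h2⟩ | ⟨h1, h2⟩
      · rw [if_pos ⟨hk, Or.inl h1⟩, if_pos ⟨hk, h1⟩, numUp_succ, if_pos h2]
      · rw [if_pos ⟨hk, Or.inr h1⟩, if_neg (by lia), numUp_succ, if_neg h2]
    · rw [if_neg (by tauto), if_neg (by tauto)]
      rfl

theorem siteBox_eq_univ {x : ℕ → ℤ} {n : ℕ} {k : ℤ} (h : ∀ i < n, x i ≠ k) :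
    siteBox x n k = Set.univ :=
  Set.eq_univ_of_forall fun _ i hi hk ↦ absurd hk (h i hi)

theorem stackWalk_eq_iff {x : ℕ → ℤ} (h0 : x 0 = 0) (n : ℕ) (ω : ℤ → ℕ → ℤ) :
    (∀ i ≤ n, stackWalk ω i = x i) ↔ ∀ k, ω k ∈ siteBox x n k := by
  induction n with
  | zero =>
    refine iff_of_true (fun i hi ↦ ?_) fun k i hi ↦ absurd hi (by lia)
    obtain rfl : i = 0 := by lia
    exact h0.symm
  | succ n ih =>
    simp only [mem_siteBox_succ, forall_and, ← ih, forall_eq']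
    have : (∀ i ≤ n + 1, stackWalk ω i = x i) ↔
        (∀ i ≤ n, stackWalk ω i = x i) ∧ stackWalk ω (n + 1) = x (n + 1) :=
      ⟨fun h ↦ ⟨fun i hi ↦ h i (by lia), h _ le_rfl⟩, fun h i hi ↦ by
        rcases Nat.le_succ_iff.1 hi with h' | rfl
        · exact h.1 i h'
        · exact h.2⟩
    rw [this]
    refine and_congr_right fun h ↦ ?_
    rw [stackWalk_succ, departures_congr h, h n le_rfl]
    split_ifs with h' <;> constructor <;> intro h'' <;> lia

theorem IsStackLaw.measure_siteBox_succ {w : ℤ → ℝ} (hw : ∀ z, 0 < w z) {ν : Measure (ℕ → ℤ)}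
    [IsProbabilityMeasure ν] (h : IsStackLaw w ν) (x : ℕ → ℤ) (n : ℕ) :
    ν (siteBox x (n + 1) (x n)) = ν (siteBox x n (x n)) * ENNReal.ofReal (stepProb w x n) := by
  set k := x n with hk
  set v := departures x n k with hv
  set δ : ℤ := dirLocP x n k - dirLocM x n k with hδ
  set A : Set (ℕ → ℤ) := siteBox x n k ∩ {c | c v = δ}
  have hA : DeterminedBy A v := (determinedBy_siteBox x n k).inter (determinedBy_coord v δ)
  have hval : ∀ c, IsNN c → c ∈ siteBox x n k → c v = δ := by
    intro c hc hc'
    have h1 := numUp_of_mem_siteBox hc'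
    have h2 := numUp_add_numDown c v
    have h3 : v = dirLocP x n k + dirLocM x n k := rfl
    rw [hc.eq_sub]
    rw [← hv] at h1
    lia
  have hAν : ν (siteBox x n k) = ν A := by
    refine measure_congr ?_
    filter_upwards [h.ae_isNN hw] with c hc
    exact propext ⟨fun hc' ↦ ⟨hc', hval c hc hc'⟩, fun hc' ↦ hc'.1⟩
  have hstep : stepProb w x n = if x (n + 1) = k + 1 then upProb w δ else
      if x (n + 1) = k - 1 then upProb w (-δ) else 0 := by
    simp only [stepProb, upProb, ← hk, ← hδ, neg_neg, add_comm (w (-δ))]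
  rw [hstep, hAν]
  have hmem : ∀ c, c ∈ siteBox x (n + 1) k ↔ c ∈ siteBox x n k ∧
      ((x (n + 1) = k + 1 ∧ c (v + 1) = c v + 1) ∨ (x (n + 1) = k - 1 ∧ c (v + 1) ≠ c v + 1)) :=
    fun c ↦ by rw [mem_siteBox_succ, ← hk]; simp [hv]
  split_ifs with h1 h2
  · rw [← h.up v A δ hA fun c hc ↦ hc.2]
    refine measure_congr ?_
    filter_upwards [h.ae_isNN hw] with c hc
    refine propext ((hmem c).trans ?_)
    constructor
    · rintro ⟨h3, h4⟩
      have := hval c hc h3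
      exact ⟨⟨h3, this⟩, show c (v + 1) = δ + 1 by lia⟩
    · rintro ⟨⟨h3, h4⟩, h5⟩
      simp only [Set.mem_ofPred_eq] at h4 h5
      exact ⟨h3, by lia⟩
  · rw [← h.down v A δ hA fun c hc ↦ hc.2]
    refine measure_congr ?_
    filter_upwards [h.ae_isNN hw] with c hc
    refine propext ((hmem c).trans ?_)
    have hc2 := hc.2 v
    constructor
    · rintro ⟨h3, h4⟩
      have := hval c hc h3
      exact ⟨⟨h3, this⟩, show c (v + 1) = δ - 1 by lia⟩
    · rintro ⟨⟨h3, h4⟩, h5⟩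
      simp only [Set.mem_ofPred_eq] at h4 h5
      exact ⟨h3, by lia⟩
  · have : siteBox x (n + 1) k = ∅ := by
      refine Set.eq_empty_of_forall_notMem fun c hc ↦ ?_
      have := ((hmem c).1 hc).2
      tauto
    rw [this]
    simp

theorem measure_stackWalk_cylinder (ν : Measure (ℕ → ℤ)) [IsProbabilityMeasure ν] {x : ℕ → ℤ}
    (h0 : x 0 = 0) (n : ℕ) {S : Finset ℤ} (hS : ∀ i < n, x i ∈ S) :
    (Measure.infinitePi fun _ : ℤ ↦ ν) {ω | ∀ i ≤ n, stackWalk ω i = x i} =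
      ∏ k ∈ S, ν (siteBox x n k) := by
  rw [← Measure.infinitePi_pi (fun _ : ℤ ↦ ν)
    fun k _ ↦ (determinedBy_siteBox x n k).measurableSet]
  congr 1
  ext ω
  simp only [Set.mem_ofPred_eq, stackWalk_eq_iff h0, Set.mem_pi, Finset.mem_coe]
  refine ⟨fun h k _ ↦ h k, fun h k ↦ ?_⟩
  by_cases hk : k ∈ S
  · exact h k hk
  · have hne : ∀ i < n, x i ≠ k := fun i hi hik ↦ hk (hik ▸ hS i hi)
    rw [siteBox_eq_univ hne]
    trivial

theorem IsStackLaw.isSRW_stackWalk {w : ℤ → ℝ} (hw : ∀ z, 0 < w z) {ν : Measure (ℕ → ℤ)}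
    [IsProbabilityMeasure ν] (h : IsStackLaw w ν) :
    IsSRW (Measure.infinitePi fun _ : ℤ ↦ ν) w fun n ω ↦ stackWalk ω n := by
  refine ⟨measurable_stackWalk, ?_, fun n x ↦ ?_⟩
  · simp [stackWalk_zero]
  · by_cases h0 : x 0 = 0
    · have hS : ∀ i < n + 1, x i ∈ Finset.image x (Finset.range (n + 1)) := fun i hi ↦
        Finset.mem_image_of_mem x (Finset.mem_range.2 hi)
      rw [measure_stackWalk_cylinder ν h0 (n + 1) hS,
        measure_stackWalk_cylinder ν h0 n fun i hi ↦ hS i (by lia),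
        ← Finset.mul_prod_erase _ (fun k ↦ ν (siteBox x (n + 1) k)) (hS n (by lia)),
        ← Finset.mul_prod_erase _ (fun k ↦ ν (siteBox x n k)) (hS n (by lia)),
        h.measure_siteBox_succ hw, mul_right_comm]
      congr 2
      refine Finset.prod_congr rfl fun k hk ↦ ?_
      congr 1
      ext c
      rw [mem_siteBox_succ]
      exact and_iff_left fun hk' ↦ absurd hk' (Finset.ne_of_mem_erase hk).symm
    · have hempty : ∀ m, {ω : ℤ → ℕ → ℤ | ∀ i ≤ m, stackWalk ω i = x i} = ∅ := fun m ↦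
        Set.eq_empty_of_forall_notMem fun ω hω ↦ h0 (hω 0 (by lia)).symm
      rw [hempty, hempty]
      simp

theorem IsSRW.measure_cylinder_zero {w : ℤ → ℝ} {Ω : Type*} [MeasurableSpace Ω] {μ : Measure Ω}
    [IsProbabilityMeasure μ] {X : ℕ → Ω → ℤ} (hX : IsSRW μ w X) (x : ℕ → ℤ) :
    μ {ω | ∀ i ≤ 0, X i ω = x i} = if x 0 = 0 then 1 else 0 := by
  have h := (mem_ae_iff_prob_eq_one (hX.1 0 (MeasurableSet.singleton 0))).2 hX.2.1
  split_ifs with h0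
  · rw [← hX.2.1]
    congr 1
    ext ω
    simp [h0]
  · refine measure_eq_zero_iff_ae_notMem.2 ?_
    filter_upwards [h] with ω hω hω'
    exact h0 ((hω' 0 le_rfl).symm.trans hω)

theorem IsSRW.measure_cylinder_eq {w : ℤ → ℝ} {Ω Ω' : Type*} [MeasurableSpace Ω]
    [MeasurableSpace Ω'] {μ : Measure Ω} {μ' : Measure Ω'} [IsProbabilityMeasure μ]
    [IsProbabilityMeasure μ'] {X : ℕ → Ω → ℤ} {X' : ℕ → Ω' → ℤ} (hX : IsSRW μ w X)
    (hX' : IsSRW μ' w X') (x : ℕ → ℤ) (n : ℕ) :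
    μ {ω | ∀ i ≤ n, X i ω = x i} = μ' {ω | ∀ i ≤ n, X' i ω = x i} := by
  induction n with
  | zero => rw [hX.measure_cylinder_zero, hX'.measure_cylinder_zero]
  | succ n ih => rw [hX.2.2, hX'.2.2, ih]

theorem ext_of_cylinder {L L' : Measure (ℕ → ℤ)} [IsProbabilityMeasure L]
    (h : ∀ (x : ℕ → ℤ) (n : ℕ), L {z | ∀ i ≤ n, z i = x i} = L' {z | ∀ i ≤ n, z i = x i}) :
    L = L' := by
  let P : (I : Finset ℕ) → Measure (I → ℤ) := fun I ↦ L.map I.restrict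
  have hLP : IsProjectiveLimit (α := fun _ : ℕ ↦ ℤ) L P := fun I ↦ rfl
  have hP : IsProjectiveMeasureFamily (α := fun _ : ℕ ↦ ℤ) P := fun I J hJI ↦ by
    simp only [P]
    rw [Measure.map_map (by fun_prop) (by fun_prop)]
    rfl
  have : ∀ I, IsFiniteMeasure (P I) := fun I ↦ by
    have := Measure.isProbabilityMeasure_map (μ := L)
      (Finset.measurable_restrict (X := fun _ ↦ ℤ) I).aemeasurable
    infer_instance
  refine hLP.unique ((isProjectiveLimit_nat_iff' hP L' 0).2 fun n _ ↦ ?_)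
  change L'.map (frestrictLe n) = L.map (frestrictLe n)
  refine Measure.ext_of_singleton fun y ↦ ?_
  obtain ⟨x, rfl⟩ : ∃ x : ℕ → ℤ, frestrictLe (π := fun _ ↦ ℤ) n x = y :=
    ⟨fun i ↦ if hi : i ≤ n then y ⟨i, Finset.mem_Iic.2 hi⟩ else 0, by
      ext ⟨i, hi⟩
      simp [Finset.mem_Iic.1 hi]⟩
  rw [Measure.map_apply (measurable_frestrictLe n) (MeasurableSet.singleton _),
    Measure.map_apply (measurable_frestrictLe n) (MeasurableSet.singleton _)]
  have hset : ∀ z : ℕ → ℤ, frestrictLe (π := fun _ ↦ ℤ) n z = frestrictLe n x ↔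
      ∀ i ≤ n, z i = x i := by
    intro z
    simp [funext_iff]
  simp only [Set.preimage, Set.mem_singleton_iff, hset]
  exact (h x n).symm

theorem IsSRW.map_eq {w : ℤ → ℝ} {Ω Ω' : Type*} [MeasurableSpace Ω]
    [MeasurableSpace Ω'] {μ : Measure Ω} {μ' : Measure Ω'} [IsProbabilityMeasure μ]
    [IsProbabilityMeasure μ'] {X : ℕ → Ω → ℤ} {X' : ℕ → Ω' → ℤ} (hX : IsSRW μ w X)
    (hX' : IsSRW μ' w X') :
    μ.map (fun ω n ↦ X n ω) = μ'.map (fun ω n ↦ X' n ω) := by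
  have hm : Measurable fun ω n ↦ X n ω := measurable_pi_lambda _ hX.1
  have hm' : Measurable fun ω n ↦ X' n ω := measurable_pi_lambda _ hX'.1
  have := Measure.isProbabilityMeasure_map (μ := μ) hm.aemeasurable
  refine ext_of_cylinder fun x n ↦ ?_
  have hA : MeasurableSet {z : ℕ → ℤ | ∀ i ≤ n, z i = x i} :=
    DeterminedBy.measurableSet (n := n) fun z z' h hz i hi ↦ (h i hi).symm.trans (hz i hi)
  rw [Measure.map_apply hm hA, Measure.map_apply hm' hA]
  exact hX.measure_cylinder_eq hX' x n

theorem dirLocP_mono (x : ℕ → ℤ) (k : ℤ) : Monotone fun n ↦ dirLocP x n k :=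
  monotone_nat_of_le_succ fun n ↦ by rw [dirLocP_succ]; lia

theorem dirLocM_mono (x : ℕ → ℤ) (k : ℤ) : Monotone fun n ↦ dirLocM x n k :=
  monotone_nat_of_le_succ fun n ↦ by rw [dirLocM_succ]; lia

theorem exists_le_of_frequently_lt_succ {f : ℕ → ℕ} (hf : Monotone f)
    (h : ∀ N, ∃ n ≥ N, f n < f (n + 1)) (r : ℕ) : ∃ n, r ≤ f n := by
  induction r with
  | zero => exact ⟨0, Nat.zero_le _⟩
  | succ r ih =>
    obtain ⟨N, hN⟩ := ih
    obtain ⟨n, hn, hlt⟩ := h N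
    exact ⟨n + 1, by have := hf hn; lia⟩

theorem le_of_forall_ge_succ_le {f : ℕ → ℕ} (hf : Monotone f) {N : ℕ}
    (h : ∀ n ≥ N, f (n + 1) ≤ f n) (n : ℕ) : f n ≤ f N := by
  rcases le_total n N with hn | hn
  · exact hf hn
  · induction n, hn using Nat.le_induction with
    | base => exact le_rfl
    | succ n hn ih => exact (h n hn).trans ih

/-- Along a nearest-neighbour path from `0`, an edge to the right of `0` is crossed to the right
as often as to the left, up to one crossing if the path currently lies to the right of the edge. -/
theorem IsNN.dirLocP_eq {x : ℕ → ℤ} (hx : IsNN x) (n : ℕ) {k : ℤ} (hk : 0 ≤ k) :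
    dirLocP x n k = dirLocM x n (k + 1) + if k < x n then 1 else 0 := by
  induction n with
  | zero =>
    rw [hx.1, if_neg (by lia)]
    simp [dirLocP, dirLocM]
  | succ n ih =>
    rw [dirLocP_succ, dirLocM_succ, ih]
    rcases hx.2 n with h | h <;> rw [h] <;> split_ifs <;> lia

theorem frequently_down_of_frequently {ω : ℤ → ℕ → ℤ} (hω : ∀ k a, upTotal (ω k) a ≠ ∞) {k : ℤ}
    (h : ∀ N, ∃ n ≥ N, stackWalk ω n = k) (N : ℕ) :
    ∃ n ≥ N, stackWalk ω n = k ∧ stackWalk ω (n + 1) = k - 1 := by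
  by_contra! hN
  have hD : ∀ n, numDown (ω k) (departures (stackWalk ω) n k) ≤ dirLocM (stackWalk ω) N k := by
    intro n
    rw [← dirLocM_stackWalk]
    refine le_of_forall_ge_succ_le (dirLocM_mono (stackWalk ω) k) (fun m hm ↦ ?_) n
    have := hN m hm
    rw [dirLocM_succ, if_neg (by tauto)]
    rfl
  have hU : ∀ n, numUp (ω k) (departures (stackWalk ω) n k) ≤
      overshoot (ω k) (dirLocM (stackWalk ω) N k + 1) := by
    intro n
    refine numUp_le_overshoot (hω _ _) fun i hi _ ↦ ?_
    have := numDown_mono (ω k) hi.le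
    have := hD n
    lia
  obtain ⟨n, hn⟩ := exists_le_of_frequently_lt_succ (departures_mono (stackWalk ω) k)
    (fun N ↦ by
      obtain ⟨n, hn, hk⟩ := h N
      have := (isNN_stackWalk ω).2 n
      rw [hk] at this
      exact ⟨n, hn, by rw [departures_succ, if_pos ⟨hk, this⟩]; lia⟩)
    (overshoot (ω k) (dirLocM (stackWalk ω) N k + 1) + dirLocM (stackWalk ω) N k + 1)
  have h1 := hU n
  have h2 := hD n
  have h3 := numUp_add_numDown (ω k) (departures (stackWalk ω) n k)
  lia

theorem dirLocP_stackWalk_le_edgeChain {ω : ℤ → ℕ → ℤ} (hω : ∀ k a, upTotal (ω k) a ≠ ∞) {r : ℕ}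
    (hr : ∀ n, dirLocP (stackWalk ω) n 0 ≤ r) (k n : ℕ) :
    dirLocP (stackWalk ω) n k ≤ edgeChain r ω k := by
  induction k generalizing n with
  | zero => exact_mod_cast hr n
  | succ k ih =>
    push_cast
    rw [dirLocP_stackWalk]
    suffices h : ∀ i < departures (stackWalk ω) n (k + 1),
        numDown (ω (k + 1)) i < edgeChain r ω k from
      numUp_le_overshoot (hω _ _) fun i hi _ ↦ h i hi
    induction n with
    | zero => exact fun i hi ↦ absurd hi (Nat.not_lt_zero i)
    | succ n ihn =>
      intro i hi
      rw [departures_succ] at hi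
      by_cases hin : i < departures (stackWalk ω) n (k + 1)
      · exact ihn i hin
      · split_ifs at hi with hc
        · obtain rfl : i = departures (stackWalk ω) n (k + 1) := by lia
          have h1 := (isNN_stackWalk ω).dirLocP_eq n (k := k) (by lia)
          rw [if_pos (by lia)] at h1
          have h2 := ih n
          rw [← dirLocM_stackWalk]
          lia
        · lia

theorem not_tendsto_stackWalk {ω : ℤ → ℕ → ℤ} (hω : ∀ k a, upTotal (ω k) a ≠ ∞)
    (hdie : ∀ r, ∃ k, edgeChain r ω k = 0) :
    ¬ ∀ M : ℤ, ∃ N, ∀ n ≥ N, M ≤ stackWalk ω n := by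
  intro h
  obtain ⟨N, hN⟩ := h 1
  obtain ⟨K, hK⟩ := hdie (dirLocP (stackWalk ω) N 0)
  have hr : ∀ n, dirLocP (stackWalk ω) n 0 ≤ dirLocP (stackWalk ω) N 0 :=
    le_of_forall_ge_succ_le (dirLocP_mono (stackWalk ω) 0) fun n hn ↦ by
      have := hN n hn
      rw [dirLocP_succ, if_neg (by lia)]
      rfl
  have hle : ∀ n, stackWalk ω n ≤ K := by
    intro n
    induction n with
    | zero => rw [stackWalk_zero]; lia
    | succ n ih =>
      have h1 := dirLocP_stackWalk_le_edgeChain hω hr K (n + 1)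
      rw [hK, dirLocP_succ] at h1
      have h2 := (isNN_stackWalk ω).2 n
      by_contra h3
      rw [if_pos (by lia)] at h1
      lia
  obtain ⟨n, hn⟩ := h (K + 1)
  have := hn n le_rfl
  have := hle n
  lia

/-- Nearest-neighbour paths which do not diverge to `+∞` and which step down infinitely often from
every site visited infinitely often. -/
def IsDownRecurrent (x : ℕ → ℤ) : Prop :=
  IsNN x ∧ (∀ k : ℤ, (∀ N : ℕ, ∃ n ≥ N, x n = k) → ∀ N : ℕ, ∃ n ≥ N, x n = k ∧ x (n + 1) = k - 1) ∧
    ¬ ∀ M : ℤ, ∃ N : ℕ, ∀ n ≥ N, M ≤ x n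

theorem measurableSet_isDownRecurrent : MeasurableSet {x | IsDownRecurrent x} := by
  have hc : ∀ (n : ℕ) (k : ℤ), Measurable fun x : ℕ → ℤ ↦ x n = k := fun n k ↦
    (determinedBy_coord n k).measurableSet.mem
  have hM : ∀ (n : ℕ) (k : ℤ), Measurable fun x : ℕ → ℤ ↦ k ≤ x n := fun n k ↦
    (DeterminedBy.measurableSet (A := {x | k ≤ x n}) (n := n)
      fun c c' h (hc : k ≤ c n) ↦ show k ≤ c' n from h n le_rfl ▸ hc).mem
  have hs : ∀ n : ℕ, Measurable fun x : ℕ → ℤ ↦ x (n + 1) = x n + 1 ∨ x (n + 1) = x n - 1 := fun n ↦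
    (DeterminedBy.measurableSet
      (A := {x : ℕ → ℤ | x (n + 1) = x n + 1 ∨ x (n + 1) = x n - 1}) (n := n + 1)
      fun c c' h hc ↦ by
        simp only [Set.mem_ofPred_eq] at hc ⊢
        rwa [← h n (by lia), ← h (n + 1) le_rfl]).mem
  refine measurableSet_setOfPred.2 ?_
  unfold IsDownRecurrent IsNN
  refine ((hc 0 0).and (.forall hs)).and (.and (.forall fun k ↦ .imp (.forall fun N ↦ .exists
    fun n ↦ .and measurable_const (hc n k)) (.forall fun N ↦ .exists fun n ↦ .and measurable_const
    ((hc n k).and (hc (n + 1) (k - 1))))) (.not (.forall fun M ↦ .exists fun N ↦ .forall fun n ↦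
    .imp measurable_const (hM n M))))

theorem IsSRW.ae_isDownRecurrent {w : ℤ → ℝ} (hw : ∀ z, 0 < w z) (hmono : Monotone w)
    {Ω : Type*} [MeasurableSpace Ω] {μ : Measure Ω} [IsProbabilityMeasure μ] {X : ℕ → Ω → ℤ}
    (hX : IsSRW μ w X) : ∀ᵐ ω ∂μ, IsDownRecurrent fun n ↦ X n ω := by
  obtain ⟨ν, hν, h⟩ := exists_isStackLaw hw
  set Q := Measure.infinitePi fun _ : ℤ ↦ ν
  have hfin : ∀ᵐ ω ∂Q, ∀ k a, upTotal (ω k) a ≠ ∞ := by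
    refine ae_all_iff.2 fun k ↦ ae_all_iff.2 fun a ↦ ?_
    have h1 : ∀ᵐ c ∂ν, upTotal c a < ∞ := ae_lt_top (measurable_upTotal a)
      ((h.lintegral_upTotal_le hw hmono a).trans_lt (ENNReal.natCast_lt_top a)).ne
    have h2 : Q.map (fun ω ↦ ω k) = ν := Measure.infinitePi_map_eval (fun _ : ℤ ↦ ν) k
    rw [← h2] at h1
    filter_upwards [ae_of_ae_map (measurable_pi_apply k).aemeasurable h1] with ω hω using hω.ne
  have hdie : ∀ᵐ ω ∂Q, ∀ r, ∃ k, edgeChain r ω k = 0 :=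
    ae_all_iff.2 fun r ↦ h.ae_exists_edgeChain_eq_zero hw hmono r
  have hY : ∀ᵐ ω ∂Q, IsDownRecurrent fun n ↦ stackWalk ω n := by
    filter_upwards [hfin, hdie] with ω h1 h2
    exact ⟨isNN_stackWalk ω, fun k hk ↦ frequently_down_of_frequently h1 hk,
      not_tendsto_stackWalk h1 h2⟩
  have hm : Measurable fun ω n ↦ X n ω := measurable_pi_lambda _ hX.1
  have hm' : Measurable fun ω n ↦ stackWalk ω n := measurable_pi_lambda _ measurable_stackWalk
  refine ae_of_ae_map hm.aemeasurable (p := IsDownRecurrent) ?_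
  rw [hX.map_eq (h.isSRW_stackWalk hw)]
  exact (ae_map_iff hm'.aemeasurable measurableSet_isDownRecurrent).2 hY

theorem dirLocP_neg (x : ℕ → ℤ) (n : ℕ) (k : ℤ) :
    dirLocP (fun i ↦ -x i) n (-k) = dirLocM x n k := by
  unfold dirLocP dirLocM
  congr 1
  exact Finset.filter_congr fun i _ ↦ by lia

theorem dirLocM_neg (x : ℕ → ℤ) (n : ℕ) (k : ℤ) :
    dirLocM (fun i ↦ -x i) n (-k) = dirLocP x n k := by
  unfold dirLocP dirLocM
  congr 1
  exact Finset.filter_congr fun i _ ↦ by lia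

theorem stepProb_neg (w : ℤ → ℝ) (x : ℕ → ℤ) (n : ℕ) :
    stepProb w (fun i ↦ -x i) n = stepProb w x n := by
  simp only [stepProb, dirLocP_neg, dirLocM_neg]
  rw [← neg_sub (dirLocP x n (x n) : ℤ), neg_neg]
  generalize (dirLocP x n (x n) : ℤ) - dirLocM x n (x n) = δ
  rw [add_comm (w (-δ))]
  split_ifs <;> first | rfl | lia

theorem IsSRW.neg {w : ℤ → ℝ} {Ω : Type*} [MeasurableSpace Ω] {μ : Measure Ω} {X : ℕ → Ω → ℤ}
    (hX : IsSRW μ w X) : IsSRW μ w fun n ω ↦ -X n ω := by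
  refine ⟨fun n ↦ (hX.1 n).neg, by simpa using hX.2.1, fun n x ↦ ?_⟩
  have := hX.2.2 n fun i ↦ -x i
  rw [stepProb_neg] at this
  simpa only [neg_eq_iff_eq_neg] using this

theorem IsDownRecurrent.exists_frequently {x : ℕ → ℤ} (hx : IsDownRecurrent x) {N : ℕ}
    (h0 : ∀ n ≥ N, x n ≠ 0) (hN : 0 < x N) : ∃ k, ∀ N, ∃ n ≥ N, x n = k := by
  by_contra! h
  have hpos : ∀ n ≥ N, 0 < x n := by
    intro n hn
    induction n, hn using Nat.le_induction with
    | base => exact hN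
    | succ n hn ih =>
      have h1 := h0 (n + 1) (by lia)
      rcases hx.1.2 n with h2 | h2 <;> lia
  refine hx.2.2 fun M ↦ ?_
  rcases le_total M 1 with hM | hM
  · exact ⟨N, fun n hn ↦ hM.trans (hpos n hn)⟩
  · induction M, hM using Int.leInduction with
    | base => exact ⟨N, fun n hn ↦ hpos n hn⟩
    | succ M _ ih =>
      obtain ⟨N₁, h1⟩ := ih
      obtain ⟨N₂, h2⟩ := h M
      refine ⟨max N₁ N₂, fun n hn ↦ ?_⟩
      have := h1 n (by lia)
      have := h2 n (by lia)
      lia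

/-- A path which is recurrent in both directions crosses every directed edge infinitely often. -/
theorem IsDownRecurrent.frequently_edge {x : ℕ → ℤ} (hx : IsDownRecurrent x)
    (hx' : IsDownRecurrent fun n ↦ -x n) (k : ℤ) (N : ℕ) :
    (∃ n ≥ N, x n = k ∧ x (n + 1) = k + 1) ∧ (∃ n ≥ N, x n = k ∧ x (n + 1) = k - 1) := by
  have hup : ∀ k : ℤ, (∀ N, ∃ n ≥ N, x n = k) → ∀ N, ∃ n ≥ N, x n = k ∧ x (n + 1) = k + 1 := by
    intro k hk N
    obtain ⟨n, hn, h1, h2⟩ := hx'.2.1 (-k) (fun N ↦ by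
      obtain ⟨n, hn, h⟩ := hk N
      exact ⟨n, hn, by lia⟩) N
    exact ⟨n, hn, by lia, by lia⟩
  obtain ⟨k₀, hk₀⟩ : ∃ k, ∀ N, ∃ n ≥ N, x n = k := by
    by_contra hno
    have h0 : ∃ N, ∀ n ≥ N, x n ≠ 0 := by
      by_contra! h
      exact hno ⟨0, h⟩
    obtain ⟨N, hN⟩ := h0
    rcases lt_or_gt_of_ne (hN N le_rfl) with h | h
    · obtain ⟨k, hk⟩ := hx'.exists_frequently (N := N)
        (fun n hn ↦ by simpa using hN n hn) (by simpa using h)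
      refine hno ⟨-k, fun N ↦ ?_⟩
      obtain ⟨n, hn, h1⟩ := hk N
      exact ⟨n, hn, by lia⟩
    · exact hno (hx.exists_frequently hN h)
  have hall : ∀ k : ℤ, ∀ N, ∃ n ≥ N, x n = k := by
    intro k
    induction k using Int.inductionOn' (b := k₀) with
    | zero => exact hk₀
    | succ k _ ih =>
      intro N
      obtain ⟨n, hn, -, h⟩ := hup k ih N
      exact ⟨n + 1, by lia, h⟩
    | pred k _ ih =>
      intro N
      obtain ⟨n, hn, -, h⟩ := hx.2.1 k ih N
      exact ⟨n + 1, by lia, h⟩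
  exact ⟨hup k (hall k) N, hx.2.1 k (hall k) N⟩

theorem dirLocP_le (x : ℕ → ℤ) (n : ℕ) (k : ℤ) : dirLocP x n k ≤ n :=
  (Finset.card_filter_le _ _).trans (Finset.card_range n).le

theorem dirLocM_le (x : ℕ → ℤ) (n : ℕ) (k : ℤ) : dirLocM x n k ≤ n :=
  (Finset.card_filter_le _ _).trans (Finset.card_range n).le

theorem finite_visited_edges (x : ℕ → ℤ) (n : ℕ) :
    {k : ℤ | 0 < dirLocP x n k + dirLocM x n (k + 1)}.Finite := by
  refine (((Finset.range n).image x) ∪ ((Finset.range n).image fun i ↦ x i - 1)).finite_toSet.subset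
    fun k hk ↦ ?_
  simp only [Finset.coe_union, Finset.coe_image, Set.mem_union, Set.mem_image, Finset.mem_coe]
  rcases Nat.add_pos_iff_pos_or_pos.1 hk with h | h
  · obtain ⟨i, hi⟩ := Finset.card_pos.1 h
    rw [Finset.mem_filter] at hi
    exact Or.inl ⟨i, hi.1, hi.2.1⟩
  · obtain ⟨i, hi⟩ := Finset.card_pos.1 h
    rw [Finset.mem_filter] at hi
    exact Or.inr ⟨i, hi.1, by rw [hi.2.1]; ring⟩

/-- almost surely, all inverse local times `T±_{j,r}` (for `r ≤ m`) are
finite, the visited range `ρ±_{j,r} - λ±_{j,r}` is finite, and `sup_k Λ±_{j,r}(k)` is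
finite; in particular the walk a.s. traverses every oriented edge of `ℤ` infinitely
often (hence visits every site infinitely often). -/
theorem stmt_13 (w : ℤ → ℝ) (hw : GoodWeight w)
    {Ω : Type*} [MeasurableSpace Ω] (μ : Measure Ω) [IsProbabilityMeasure μ]
    (X : ℕ → Ω → ℤ) (hX : IsSRW μ w X) (j : ℤ) (m : ℕ) :
    μ {ω | ∀ r ≤ m,
        {n : ℕ | r ≤ dirLocP (fun i => X i ω) n j}.Nonempty ∧
        {n : ℕ | r ≤ dirLocM (fun i => X i ω) n j}.Nonempty ∧
        BddBelow {k : ℤ | 0 < LamP (fun i => X i ω) j r k} ∧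
        BddAbove {k : ℤ | 0 < LamP (fun i => X i ω) j r k} ∧
        BddBelow {k : ℤ | 0 < LamM (fun i => X i ω) j r k} ∧
        BddAbove {k : ℤ | 0 < LamM (fun i => X i ω) j r k} ∧
        (∃ M : ℕ, ∀ k : ℤ, LamP (fun i => X i ω) j r k ≤ M) ∧
        (∃ M : ℕ, ∀ k : ℤ, LamM (fun i => X i ω) j r k ≤ M)} = 1 ∧
    μ {ω | ∀ k : ℤ, ∀ N : ℕ, (∃ n ≥ N, X n ω = k ∧ X (n + 1) ω = k + 1) ∧
        (∃ n ≥ N, X n ω = k ∧ X (n + 1) ω = k - 1)} = 1 := by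
  have hmono : Monotone w := monotone_int_of_le_succ hw.2.1
  have hae : ∀ᵐ ω ∂μ, ∀ (k : ℤ) (N : ℕ), (∃ n ≥ N, X n ω = k ∧ X (n + 1) ω = k + 1) ∧
      (∃ n ≥ N, X n ω = k ∧ X (n + 1) ω = k - 1) := by
    filter_upwards [hX.ae_isDownRecurrent hw.1 hmono, hX.neg.ae_isDownRecurrent hw.1 hmono]
      with ω h1 h2 using h1.frequently_edge h2
  have hone : ∀ s : Set Ω, (∀ᵐ ω ∂μ, ω ∈ s) → μ s = 1 := fun s hs ↦ by
    exact (measure_congr (eventuallyEq_univ.2 hs)).trans measure_univ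
  refine ⟨hone _ ?_, hone _ hae⟩
  filter_upwards [hae] with ω hω r _
  refine ⟨?_, ?_, (finite_visited_edges _ _).bddBelow, (finite_visited_edges _ _).bddAbove,
    (finite_visited_edges _ _).bddBelow, (finite_visited_edges _ _).bddAbove,
    ⟨_, fun k ↦ add_le_add (dirLocP_le _ _ _) (dirLocM_le _ _ _)⟩,
    ⟨_, fun k ↦ add_le_add (dirLocP_le _ _ _) (dirLocM_le _ _ _)⟩⟩
  · refine exists_le_of_frequently_lt_succ (dirLocP_mono (fun i ↦ X i ω) j) (fun N ↦ ?_) r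
    obtain ⟨n, hn, h⟩ := (hω j N).1
    exact ⟨n, hn, by rw [dirLocP_succ, if_pos h]; lia⟩
  · refine exists_le_of_frequently_lt_succ (dirLocM_mono (fun i ↦ X i ω) j) (fun N ↦ ?_) r
    obtain ⟨n, hn, h⟩ := (hω j N).2
    exact ⟨n, hn, by rw [dirLocM_succ, if_pos h]; lia⟩
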